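/- arXiv:1812.02477 — 2 statements merged into one kernel-verified Lean document; each statement's English description precedes it below -/
import Mathlib

section
/- Max-consensus on a connected network is achieved in at most diameter-many steps: for every k ≥ l and every vertex i, the k-th iterate of the local-max update satisfies f^[k](x)(i) = max over all vertices j of x(j). -/
open scoped Classical

/-- Closed neighborhood of `i` in `G`. -/
noncomputable def closedNbhd {n : ℕ} (G : SimpleGraph (Fin n)) (i : Fin n) :
    Finset (Fin n) :=
  Finset.univ.filter (fun h => h = i ∨ G.Adj i h)

lemma self_mem_closedNbhd {n : ℕ} (G : SimpleGraph (Fin n)) (i : Fin n) :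
    i ∈ closedNbhd G i := by simp [closedNbhd]

/-- The local-max update: every vertex replaces its value by the maximum of the
values in its closed neighborhood. -/
noncomputable def maxStep {n : ℕ} (G : SimpleGraph (Fin n)) (y : Fin n → ℝ) :
    Fin n → ℝ := fun i =>
  (closedNbhd G i).sup' ⟨i, self_mem_closedNbhd G i⟩ y

lemma le_maxStep {n : ℕ} {G : SimpleGraph (Fin n)} (y : Fin n → ℝ) {i j : Fin n}
    (h : j = i ∨ G.Adj i j) : y j ≤ maxStep G y i :=
  Finset.le_sup' y (by simpa [closedNbhd] using h)

lemma maxStep_le {n : ℕ} {G : SimpleGraph (Fin n)} {y : Fin n → ℝ} {M : ℝ}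
    (h : ∀ j, y j ≤ M) (i : Fin n) : maxStep G y i ≤ M :=
  Finset.sup'_le _ _ fun j _ => h j

lemma iterate_maxStep_le {n : ℕ} {G : SimpleGraph (Fin n)} {x : Fin n → ℝ} {M : ℝ}
    (h : ∀ j, x j ≤ M) (k : ℕ) (i : Fin n) : (maxStep G)^[k] x i ≤ M := by
  induction k generalizing i with
  | zero => exact h i
  | succ k ih =>
    rw [Function.iterate_succ_apply']
    exact maxStep_le ih i

lemma le_iterate_maxStep_of_walk {n : ℕ} {G : SimpleGraph (Fin n)} (x : Fin n → ℝ) {k : ℕ}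
    {i j : Fin n} (p : G.Walk i j) (hp : p.length ≤ k) : x j ≤ (maxStep G)^[k] x i := by
  induction k generalizing i with
  | zero => exact (congrArg x (p.eq_of_length_eq_zero (Nat.le_zero.mp hp)).symm).le
  | succ k ih =>
    rw [Function.iterate_succ_apply']
    cases p with
    | nil => exact (ih .nil (Nat.zero_le k)).trans (le_maxStep _ (Or.inl rfl))
    | cons hadj q =>
      exact (ih q (Nat.le_of_succ_le_succ hp)).trans (le_maxStep _ (Or.inr hadj))

/-- Max-consensus on a connected network is achieved in at
most diameter-many steps: for every `k ≥ l` (with `l` the diameter of the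
connected graph `G`) and every vertex `i`, the `k`-th iterate of the local-max
update at `i` equals the maximum of the initial values over all vertices. -/
theorem max_consensus_in_diam_steps {n : ℕ} (hn : 1 ≤ n)
    (G : SimpleGraph (Fin n)) (hG : G.Connected)
    (l : ℕ) (hl : l = G.diam)
    (x : Fin n → ℝ) (k : ℕ) (hk : l ≤ k) (i : Fin n) :
    (maxStep G)^[k] x i =
      Finset.univ.sup' ⟨i, Finset.mem_univ i⟩ x := by
  apply le_antisymm
  · exact iterate_maxStep_le (fun j => Finset.le_sup' x (Finset.mem_univ j)) k i
  · refine Finset.sup'_le _ _ fun j _ => ?_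
    have : Nonempty (Fin n) := ⟨i⟩
    obtain ⟨p, hp⟩ := hG.exists_walk_length_eq_dist i j
    have hdist : G.dist i j ≤ G.diam :=
      SimpleGraph.dist_le_diam (SimpleGraph.connected_iff_ediam_ne_top.mp hG)
    exact le_iterate_maxStep_of_walk x p (by omega)
end

section
/- The iterated local-max update computes the maximum over graph balls: for every k ∈ ℕ and every vertex i, f^[k](x)(i) equals the maximum of x(j) over all vertices j whose shortest-path distance to i in G is at most k. -/
open scoped Classical

/-- The ball of radius `k` around `i`: all vertices at shortest-path distance
at most `k` from `i`. -/
noncomputable def distBall {n : ℕ} (G : SimpleGraph (Fin n)) (i : Fin n)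
    (k : ℕ) : Finset (Fin n) :=
  Finset.univ.filter (fun j => G.dist i j ≤ k)

lemma self_mem_distBall {n : ℕ} (G : SimpleGraph (Fin n)) (i : Fin n) (k : ℕ) :
    i ∈ distBall G i k := by simp [distBall, SimpleGraph.dist_self]

/-- A vertex lies in the ball of radius `k + 1` around `i` iff it lies in the ball of radius `k`
around some vertex of the closed neighborhood of `i`. -/
lemma mem_distBall_succ_iff {n : ℕ} {G : SimpleGraph (Fin n)} (hG : G.Connected)
    (i j : Fin n) (k : ℕ) :
    j ∈ distBall G i (k + 1) ↔ ∃ h ∈ closedNbhd G i, j ∈ distBall G h k := by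
  simp only [distBall, closedNbhd, Finset.mem_filter, Finset.mem_univ, true_and]
  constructor
  · intro hj
    obtain ⟨p, hp⟩ := hG.exists_walk_length_eq_dist i j
    cases p with
    | nil => exact ⟨i, Or.inl rfl, by simp⟩
    | cons hadj q =>
      refine ⟨_, Or.inr hadj, (SimpleGraph.dist_le q).trans ?_⟩
      rw [SimpleGraph.Walk.length_cons] at hp
      omega
  · rintro ⟨h, rfl | hadj, hj⟩
    · omega
    · have htri := hG.dist_triangle (u := i) (v := h) (w := j)
      rw [SimpleGraph.dist_eq_one_iff_adj.mpr hadj] at htri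
      omega

lemma maxStep_le_iff {n : ℕ} (G : SimpleGraph (Fin n)) (y : Fin n → ℝ) (i : Fin n) (c : ℝ) :
    maxStep G y i ≤ c ↔ ∀ h ∈ closedNbhd G i, y h ≤ c :=
  Finset.sup'_le_iff _ _

lemma iterate_maxStep_le_iff {n : ℕ} {G : SimpleGraph (Fin n)} (hG : G.Connected)
    (x : Fin n → ℝ) (k : ℕ) (i : Fin n) (c : ℝ) :
    (maxStep G)^[k] x i ≤ c ↔ ∀ j ∈ distBall G i k, x j ≤ c := by
  induction k generalizing i with
  | zero => simp [distBall, hG.dist_eq_zero_iff]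
  | succ k ih =>
    simp only [Function.iterate_succ_apply', maxStep_le_iff, ih, mem_distBall_succ_iff hG]
    exact ⟨fun H j ⟨h, hh, hj⟩ => H h hh j hj, fun H h hh j hj => H j ⟨h, hh, hj⟩⟩

/-- The iterated local-max update computes the maximum over
graph balls: for every `k` and every vertex `i`, `f^[k] x i` equals the
maximum of `x j` over all vertices `j` with `dist i j ≤ k`. -/
theorem iterated_maxStep_eq_ball_max {n : ℕ} (hn : 1 ≤ n)
    (G : SimpleGraph (Fin n)) (hG : G.Connected)
    (x : Fin n → ℝ) (k : ℕ) (i : Fin n) :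
    (maxStep G)^[k] x i =
      (distBall G i k).sup' ⟨i, self_mem_distBall G i k⟩ x := by
  exact eq_of_forall_ge_iff fun c =>
    (iterate_maxStep_le_iff hG x k i c).trans (Finset.sup'_le_iff _ _).symm
end
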